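/- For every positive integer n, Σ_k (−1)^k · sptbar(n − k²) = b(n), where the sum is over all integers k, sptbar counts the number of odd smallest parts in the overpartitions of n (sptbar(m)=0 for m≤0), and b(n) = (−1)^{n+1}·2s(n) if n is odd, (−1)^{n+1}·4s(n/4) if 4|n, and 0 if n ≡ 2 (mod 4), with s(k) = Σ_{d|k} min(d,k/d). -/

import Mathlib

/-- The partition function `p(n)`. -/
def partitionCount (n : ℕ) : ℕ := Fintype.card (Nat.Partition n)

/-- The smallest part of a partition (`0` for the empty partition). -/
noncomputable def Nat.Partition.smallestPart {n : ℕ} (π : n.Partition) : ℕ := sInf {a | a ∈ π.parts}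

/-- `spt(n)`: the total number of smallest parts in the partitions of `n`. -/
noncomputable def spt (n : ℕ) : ℕ := ∑ π : Nat.Partition n, π.parts.count π.smallestPart

/-- The Kronecker symbol `(12 | m)`. -/
def chi12 (m : ℕ) : ℤ :=
  if m % 12 = 1 ∨ m % 12 = 11 then 1 else if m % 12 = 5 ∨ m % 12 = 7 then -1 else 0

/-- `a(n) = −∑_{ab = 6n, 0 < a < b} (12 | b² − a²) · a`. -/
def sptRHS (n : ℕ) : ℤ :=
  - ∑ a ∈ (6 * n).divisors.filter (fun a => a < 6 * n / a),
      chi12 ((6 * n / a) ^ 2 - a ^ 2) * a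

/-- `s(k) = ∑_{d ∣ k} min(d, k/d)`. -/
def sdiv (k : ℕ) : ℕ := ∑ d ∈ k.divisors, min d (k / d)

/-- `b(n)` from Theorem 2. -/
def bfun (n : ℕ) : ℤ :=
  if n % 2 = 1 then (-1) ^ (n + 1) * (2 * sdiv n)
  else if n % 4 = 0 then (-1) ^ (n + 1) * (4 * sdiv (n / 4))
  else 0

/-- The number of overpartitions of `n`: each partition together with a choice of
a set of part sizes to overline (the first occurrence of each chosen size). -/
def overpartitionCount (n : ℕ) : ℕ :=
  ∑ π : Nat.Partition n, π.parts.toFinset.powerset.card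

/-- `sptbar(n)`: the number of odd smallest parts in the overpartitions of `n`. -/
noncomputable def sptbar (n : ℕ) : ℕ :=
  ∑ π : Nat.Partition n, ∑ _S ∈ π.parts.toFinset.powerset,
    if Odd π.smallestPart then π.parts.count π.smallestPart else 0

/-- `M2(n)`: the number of partitions of `n` without repeated odd parts. -/
def M2 (n : ℕ) : ℕ :=
  (Finset.univ.filter fun π : Nat.Partition n =>
    ∀ i ∈ π.parts, Odd i → π.parts.count i ≤ 1).card

/-- `M2spt(n)`: the number of smallest parts in those partitions of `n` without
repeated odd parts whose smallest part is even. -/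
noncomputable def M2spt (n : ℕ) : ℕ :=
  ∑ π : Nat.Partition n,
    if (∀ i ∈ π.parts, Odd i → π.parts.count i ≤ 1) ∧ Even π.smallestPart ∧ π.parts ≠ 0
    then π.parts.count π.smallestPart else 0

/-- `σ(n)`: sum of divisors. -/
def sigma1 (n : ℕ) : ℕ := ∑ d ∈ n.divisors, d

/-- `c(n) = σ(n) − σ(n/2) − s(2n)/2 + s(n/2)`, with `σ`, `s` vanishing at non-integers. -/
def cfun (n : ℕ) : ℚ :=
  (sigma1 n : ℚ) - (if 2 ∣ n then (sigma1 (n / 2) : ℚ) else 0)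
    - (sdiv (2 * n) : ℚ) / 2 + (if 2 ∣ n then (sdiv (n / 2) : ℚ) else 0)

/-- `p` extended by zero to `ℤ`. -/
def pZ (m : ℤ) : ℤ := if 0 ≤ m then (partitionCount m.toNat : ℤ) else 0

/-- `spt` extended by zero to `ℤ`. -/
noncomputable def sptZ (m : ℤ) : ℤ := if 0 ≤ m then (spt m.toNat : ℤ) else 0

/-- `sptbar` extended by zero to `ℤ`. -/
noncomputable def sptbarZ (m : ℤ) : ℤ := if 0 ≤ m then (sptbar m.toNat : ℤ) else 0

/-- `M2spt` extended by zero to `ℤ`, valued in `ℚ`. -/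
noncomputable def M2sptQ (m : ℤ) : ℚ := if 0 ≤ m then (M2spt m.toNat : ℚ) else 0

section QSeries

open Finset

variable {K : Type*} [Field K]

/-- The `q`-Pochhammer symbol `(q; q)_n`. -/
def qPoch (q : K) (n : ℕ) : K := ∏ i ∈ range n, (1 - q ^ (i + 1))

/-- The `q`-Pochhammer symbol `(-q; q)_n`. -/
def qPochNeg (q : K) (n : ℕ) : K := ∏ i ∈ range n, (1 + q ^ (i + 1))

/-- `1 / (q; q)_{a - b}`, which vanishes for `a < b`. -/
def qPochSubInv (q : K) (a b : ℕ) : K := if b ≤ a then (qPoch q (a - b))⁻¹ else 0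

lemma qPoch_zero (q : K) : qPoch q 0 = 1 := by simp [qPoch]

lemma qPochNeg_zero (q : K) : qPochNeg q 0 = 1 := by simp [qPochNeg]

lemma qPoch_succ (q : K) (n : ℕ) : qPoch q (n + 1) = qPoch q n * (1 - q ^ (n + 1)) :=
  prod_range_succ _ _

lemma qPochNeg_succ (q : K) (n : ℕ) : qPochNeg q (n + 1) = qPochNeg q n * (1 + q ^ (n + 1)) :=
  prod_range_succ _ _

lemma qPochSubInv_zero_right (q : K) (a : ℕ) : qPochSubInv q a 0 = (qPoch q a)⁻¹ := by
  simp [qPochSubInv]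

lemma qPochSubInv_of_lt (q : K) {a b : ℕ} (h : a < b) : qPochSubInv q a b = 0 := by
  simp [qPochSubInv, h]

lemma qPochSubInv_succ_succ (q : K) (a b : ℕ) :
    qPochSubInv q (a + 1) (b + 1) = qPochSubInv q a b := by
  simp [qPochSubInv]

variable {q : K}

lemma one_sub_pow_ne_zero (hq : ∀ n, q ^ (n + 1) ≠ 1) (n : ℕ) : 1 - q ^ (n + 1) ≠ 0 :=
  sub_ne_zero.mpr (hq n).symm

lemma one_add_pow_ne_zero (hq : ∀ n, q ^ (n + 1) ≠ 1) (n : ℕ) : 1 + q ^ (n + 1) ≠ 0 := by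
  intro h
  apply hq (2 * n + 1)
  linear_combination (q ^ (n + 1) - 1) * h

lemma qPoch_ne_zero (hq : ∀ n, q ^ (n + 1) ≠ 1) (n : ℕ) : qPoch q n ≠ 0 :=
  prod_ne_zero_iff.mpr fun i _ => one_sub_pow_ne_zero hq i

lemma qPochNeg_ne_zero (hq : ∀ n, q ^ (n + 1) ≠ 1) (n : ℕ) : qPochNeg q n ≠ 0 :=
  prod_ne_zero_iff.mpr fun i _ => one_add_pow_ne_zero hq i

lemma qPochSubInv_eq (hq : ∀ n, q ^ (n + 1) ≠ 1) (a b : ℕ) :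
    q ^ b * qPochSubInv q a b = (q ^ b - q ^ (a + 1)) * qPochSubInv q (a + 1) b := by
  rcases lt_trichotomy b (a + 1) with h | rfl | h
  · obtain ⟨c, rfl⟩ := Nat.exists_eq_add_of_le (Nat.lt_succ_iff.mp h)
    have h1 : b + c + 1 - b = c + 1 := by omega
    have := one_sub_pow_ne_zero hq c
    have := qPoch_ne_zero hq c
    simp only [qPochSubInv, h.le, h1, Nat.lt_succ_iff.mp h, if_true, Nat.add_sub_cancel_left,
      qPoch_succ]
    field_simp
    ring
  · simp [qPochSubInv]
  · rw [qPochSubInv_of_lt q h, qPochSubInv_of_lt q (by omega)]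
    simp

/-- Symmetric sums over `-M ≤ r ≤ M`, folded to `r ≥ 0`, of a telescoping term. -/
lemma folded_sum_telescope (F G : ℕ → K) (h : ∀ r, F r = G r - G (r + 1)) (h0 : G 1 = -G 0)
    (M : ℕ) (hM : G (M + 1) = 0) : F 0 + 2 * ∑ r ∈ range M, F (r + 1) = 0 := by
  have : ∑ r ∈ range M, F (r + 1) = G 1 - G (M + 1) := by
    simp_rw [h]
    exact sum_range_sub' (fun r => G (r + 1)) M
  rw [this, h, hM, h0]
  ring

/-- The Gauss sum `∑_{|r| ≤ m} (-1)^r / ((q)_{m-r} (q)_{m+r}) = (-1)^m / (q^2; q^2)_m`. -/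
lemma gauss_sum (hq0 : q ≠ 0) (hq : ∀ n, q ^ (n + 1) ≠ 1) (M m : ℕ) (hm : m ≤ M) :
    qPochSubInv q m 0 / qPoch q m
      + 2 * ∑ r ∈ range M, (-1) ^ (r + 1) * qPochSubInv q m (r + 1) / qPoch q (m + (r + 1))
      = (-1) ^ m / (qPoch q m * qPochNeg q m) := by
  induction m with
  | zero =>
    simp [qPochSubInv, qPoch_zero, qPochNeg_zero]
  | succ m ih =>
    specialize ih (by omega)
    have key := folded_sum_telescope
      (fun r => (1 - q ^ (2 * m + 2)) *
        ((-1) ^ r * qPochSubInv q (m + 1) r / qPoch q (m + 1 + r))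
        + (-1) ^ r * qPochSubInv q m r / qPoch q (m + r))
      (fun r => (-1) ^ r * qPochSubInv q (m + 1) r / qPoch q (m + r)) ?_ ?_ M ?_
    · simp only [sum_add_distrib, ← mul_sum] at key
      simp only [pow_zero, one_mul, add_zero] at key
      have h1 := one_sub_pow_ne_zero hq m
      have h2 := one_add_pow_ne_zero hq m
      have h3 := qPoch_ne_zero hq m
      have h4 := qPochNeg_ne_zero hq m
      have h5 : 1 - q ^ (2 * m + 2) ≠ 0 := one_sub_pow_ne_zero hq (2 * m + 1)
      apply mul_left_cancel₀ h5
      have h6 : (1 - q ^ (2 * m + 2)) * ((-1) ^ (m + 1) / (qPoch q (m + 1) * qPochNeg q (m + 1)))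
          = - ((-1) ^ m / (qPoch q m * qPochNeg q m)) := by
        rw [qPoch_succ, qPochNeg_succ]
        field_simp
        ring
      rw [h6, ← ih]
      linear_combination key
    · intro r
      have e := qPochSubInv_eq hq m r
      have h1 := one_sub_pow_ne_zero hq (m + r)
      have h3 := qPoch_ne_zero hq (m + r)
      have h4 : q ^ r ≠ 0 := pow_ne_zero _ hq0
      have h5 : m + 1 + r = m + r + 1 := by ring
      have h6 : m + (r + 1) = m + r + 1 := by ring
      have e' : qPochSubInv q m r = (q ^ r - q ^ (m + 1)) * qPochSubInv q (m + 1) r / q ^ r := by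
        field_simp
        linear_combination e
      simp only [h5, h6, qPoch_succ, qPochSubInv_succ_succ, e']
      field_simp
      ring
    · have h1 := one_sub_pow_ne_zero hq m
      have h3 := qPoch_ne_zero hq m
      simp [qPochSubInv, qPoch_succ]
      field_simp
    · rw [qPochSubInv_of_lt q (by omega)]
      simp

/-- A finite form of Gauss's theta identity:
`∑_{|r| ≤ m} (-1)^r q^{r^2} / ((q)_{m-r} (q)_{m+r}) = 1 / (q^2; q^2)_m`. -/
lemma gauss_theta_sum (hq0 : q ≠ 0) (hq : ∀ n, q ^ (n + 1) ≠ 1) (M m : ℕ) (hm : m ≤ M) :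
    qPochSubInv q m 0 / qPoch q m
      + 2 * ∑ r ∈ range M, (-1) ^ (r + 1) * q ^ (r + 1) ^ 2 * qPochSubInv q m (r + 1)
        / qPoch q (m + (r + 1))
      = 1 / (qPoch q m * qPochNeg q m) := by
  induction m with
  | zero =>
    simp [qPochSubInv, qPoch_zero, qPochNeg_zero]
  | succ m ih =>
    specialize ih (by omega)
    have key := folded_sum_telescope
      (fun r => (1 - q ^ (2 * m + 2)) *
        ((-1) ^ r * q ^ r ^ 2 * qPochSubInv q (m + 1) r / qPoch q (m + 1 + r))
        - (-1) ^ r * q ^ r ^ 2 * qPochSubInv q m r / qPoch q (m + r))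
      (fun r => (-1) ^ r * q ^ r ^ 2 * q ^ (m + 1) * qPochSubInv q (m + 1) r
        / (q ^ r * qPoch q (m + r))) ?_ ?_ M ?_
    · simp only [sum_sub_distrib, ← mul_sum] at key
      norm_num only [pow_zero, one_mul, add_zero] at key
      have h1 := one_sub_pow_ne_zero hq m
      have h2 := one_add_pow_ne_zero hq m
      have h3 := qPoch_ne_zero hq m
      have h4 := qPochNeg_ne_zero hq m
      have h5 : 1 - q ^ (2 * m + 2) ≠ 0 := one_sub_pow_ne_zero hq (2 * m + 1)
      apply mul_left_cancel₀ h5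
      have h6 : (1 - q ^ (2 * m + 2)) * (1 / (qPoch q (m + 1) * qPochNeg q (m + 1)))
          = 1 / (qPoch q m * qPochNeg q m) := by
        rw [qPoch_succ, qPochNeg_succ]
        field_simp
        ring
      rw [h6, ← ih]
      linear_combination key
    · intro r
      have e := qPochSubInv_eq hq m r
      have h1 := one_sub_pow_ne_zero hq (m + r)
      have h3 := qPoch_ne_zero hq (m + r)
      have h4 : q ^ r ≠ 0 := pow_ne_zero _ hq0
      have h5 : m + 1 + r = m + r + 1 := by ring
      have h6 : m + (r + 1) = m + r + 1 := by ring
      have h7 : q ^ (r + 1) ^ 2 = q ^ r ^ 2 * q ^ r * q ^ (r + 1) := by ring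
      have h8 : q ^ (r + 1) ≠ 0 := pow_ne_zero _ hq0
      have e' : qPochSubInv q m r = (q ^ r - q ^ (m + 1)) * qPochSubInv q (m + 1) r / q ^ r := by
        field_simp
        linear_combination e
      simp only [h5, h6, qPoch_succ, qPochSubInv_succ_succ, e', h7]
      field_simp
      ring
    · have h1 := one_sub_pow_ne_zero hq m
      have h3 := qPoch_ne_zero hq m
      simp [qPochSubInv, qPoch_succ]
      field_simp
    · rw [qPochSubInv_of_lt q (by omega)]
      simp

/-- The Bailey pair with `β_m = 1 / (q^2; q^2)_m` for odd `m` and `0` for even `m`. -/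
lemma bailey_pair_odd [CharZero K] (hq0 : q ≠ 0) (hq : ∀ n, q ^ (n + 1) ≠ 1) (M m : ℕ)
    (hm : m ≤ M) :
    ∑ r ∈ range M, (-1) ^ (r + 1) * (q ^ (r + 1) ^ 2 - 1) * (qPochSubInv q m (r + 1)
        / qPoch q (m + (r + 1)))
      = if Odd m then 1 / (qPoch q m * qPochNeg q m) else 0 := by
  have h1 := gauss_sum hq0 hq M m hm
  have h2 := gauss_theta_sum hq0 hq M m hm
  have h3 : ∑ r ∈ range M, (-1) ^ (r + 1) * (q ^ (r + 1) ^ 2 - 1) * (qPochSubInv q m (r + 1)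
        / qPoch q (m + (r + 1))) =
      ∑ r ∈ range M, (-1) ^ (r + 1) * q ^ (r + 1) ^ 2 * qPochSubInv q m (r + 1)
        / qPoch q (m + (r + 1))
      - ∑ r ∈ range M, (-1) ^ (r + 1) * qPochSubInv q m (r + 1) / qPoch q (m + (r + 1)) := by
    rw [← sum_sub_distrib]
    exact sum_congr rfl fun r _ => by ring
  rw [h3]
  have h2' : (2 : K) ≠ 0 := two_ne_zero
  apply mul_left_cancel₀ h2'
  split_ifs with h
  · rw [h.neg_one_pow] at h1
    linear_combination h2 - h1
  · rw [(Nat.not_odd_iff_even.mp h).neg_one_pow] at h1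
    linear_combination h2 - h1

/-- Summation of the Bailey kernel: a first-order recurrence in `n` for the truncated sums. -/
lemma bailey_kernel_recurrence (hq0 : q ≠ 0) (hq : ∀ n, q ^ (n + 1) ≠ 1) (N n : ℕ) (hn : 0 < n) :
    (1 - q ^ n) ^ 2 * ∑ m ∈ range N, q ^ (m + 1) * qPoch q m ^ 2 *
        (qPochSubInv q (m + 1) n / qPoch q (m + 1 + n))
      - (q ^ n) ^ 2 * (1 - q ^ (n + 1)) ^ 2 * (∑ m ∈ range N, q ^ (m + 1) * qPoch q m ^ 2 *
        (qPochSubInv q (m + 1) (n + 1) / qPoch q (m + 1 + (n + 1))))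
      = q ^ n * (1 - q ^ (2 * n + 1)) *
        (qPoch q N ^ 2 * qPochSubInv q N n / qPoch q (N + n + 1)) := by
  have h0 : qPochSubInv q 0 n = 0 := qPochSubInv_of_lt q hn
  have key := sum_range_sub (fun m => q ^ n * (1 - q ^ (2 * n + 1)) *
    (qPoch q m ^ 2 * qPochSubInv q m n / qPoch q (m + n + 1))) N
  simp only [h0, mul_zero, zero_div, sub_zero] at key
  rw [← key, mul_sum, mul_sum, ← sum_sub_distrib]
  refine sum_congr rfl fun m _ => ?_
  have e := qPochSubInv_eq hq m n
  have h1 := one_sub_pow_ne_zero hq (m + n)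
  have h2 := one_sub_pow_ne_zero hq (m + n + 1)
  have h3 := qPoch_ne_zero hq (m + n)
  have h4 : q ^ n ≠ 0 := pow_ne_zero _ hq0
  have h5 : m + 1 + n = m + n + 1 := by ring
  have h6 : m + 1 + (n + 1) = m + n + 1 + 1 := by ring
  have e' : qPochSubInv q m n = (q ^ n - q ^ (m + 1)) * qPochSubInv q (m + 1) n / q ^ n := by
    field_simp
    linear_combination e
  simp only [h5, h6, qPoch_succ, qPochSubInv_succ_succ, e']
  field_simp
  ring

/-- The elements of `K` divisible by `q ^ N` in the subring `R`. -/
def qIdeal (R : Subring K) (q : K) (N : ℕ) : AddSubgroup K :=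
  R.toAddSubgroup.map (AddMonoidHom.mulLeft (q ^ N))

lemma mem_qIdeal {R : Subring K} {N : ℕ} {x : K} :
    x ∈ qIdeal R q N ↔ ∃ r ∈ R, q ^ N * r = x := by
  simp [qIdeal]

lemma mul_mem_qIdeal {R : Subring K} {N : ℕ} {x y : K} (hx : x ∈ R) (hy : y ∈ qIdeal R q N) :
    x * y ∈ qIdeal R q N := by
  obtain ⟨r, hr, rfl⟩ := mem_qIdeal.mp hy
  exact mem_qIdeal.mpr ⟨x * r, mul_mem hx hr, by ring⟩

lemma pow_mul_mem_qIdeal {R : Subring K} {M N L : ℕ} {x : K} (hqR : q ∈ R) (h : L ≤ M + N)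
    (hx : x ∈ qIdeal R q N) : q ^ M * x ∈ qIdeal R q L := by
  obtain ⟨r, hr, rfl⟩ := mem_qIdeal.mp hx
  refine mem_qIdeal.mpr ⟨q ^ (M + N - L) * r, mul_mem (pow_mem hqR _) hr, ?_⟩
  rw [← mul_assoc, ← pow_add, ← mul_assoc, ← pow_add]
  congr 2
  omega

lemma qIdeal_mono {R : Subring K} {N L : ℕ} {x : K} (hqR : q ∈ R) (h : L ≤ N)
    (hx : x ∈ qIdeal R q N) : x ∈ qIdeal R q L := by
  simpa using pow_mul_mem_qIdeal (M := 0) hqR (by omega) hx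

lemma mul_sub_one_mem_qIdeal {R : Subring K} {N : ℕ} {x y : K} (hxR : x ∈ R)
    (hx : x - 1 ∈ qIdeal R q N) (hy : y - 1 ∈ qIdeal R q N) : x * y - 1 ∈ qIdeal R q N := by
  have : x * y - 1 = x * (y - 1) + (x - 1) := by ring
  rw [this]
  exact add_mem (mul_mem_qIdeal hxR hy) hx

lemma mem_of_sub_one_mem_qIdeal {R : Subring K} {N : ℕ} {x : K} (hqR : q ∈ R)
    (hx : x - 1 ∈ qIdeal R q N) : x ∈ R := by
  obtain ⟨r, hr, h⟩ := mem_qIdeal.mp hx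
  rw [← sub_add_cancel x 1, ← h]
  exact add_mem (mul_mem (pow_mem hqR _) hr) (one_mem _)

section Truncation

variable {R : Subring K}

lemma qPoch_add_div_sub_one_mem (hq : ∀ n, q ^ (n + 1) ≠ 1) (hqR : q ∈ R)
    (a b : ℕ) :
    qPoch q (a + b) / qPoch q a - 1 ∈ qIdeal R q (a + 1) := by
  induction b with
  | zero => simp [div_self (qPoch_ne_zero hq a), zero_mem]
  | succ b ih =>
    rw [← add_assoc, qPoch_succ, mul_div_right_comm]
    refine mul_sub_one_mem_qIdeal (mem_of_sub_one_mem_qIdeal hqR ih) ih ?_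
    refine mem_qIdeal.mpr ⟨- q ^ b, neg_mem (pow_mem hqR _), by ring⟩

lemma qPoch_div_add_sub_one_mem (hq : ∀ n, q ^ (n + 1) ≠ 1) (hqR : q ∈ R)
    (hinv : ∀ n, (1 - q ^ (n + 1))⁻¹ ∈ R) (a b : ℕ) :
    qPoch q a / qPoch q (a + b) - 1 ∈ qIdeal R q (a + 1) := by
  induction b with
  | zero => simp [div_self (qPoch_ne_zero hq a), zero_mem]
  | succ b ih =>
    rw [← add_assoc, qPoch_succ, ← div_div, div_eq_mul_inv _ (1 - _)]
    refine mul_sub_one_mem_qIdeal (mem_of_sub_one_mem_qIdeal hqR ih) ih ?_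
    refine mem_qIdeal.mpr ⟨q ^ b * (1 - q ^ (a + b + 1))⁻¹, mul_mem (pow_mem hqR _) (hinv _), ?_⟩
    have := one_sub_pow_ne_zero hq (a + b)
    field_simp
    ring

lemma qPoch_sq_ratio_sub_one_mem (hq : ∀ n, q ^ (n + 1) ≠ 1) (hqR : q ∈ R)
    (hinv : ∀ n, (1 - q ^ (n + 1))⁻¹ ∈ R) {N n : ℕ} (hn : n ≤ N) (k : ℕ) :
    qPoch q N ^ 2 * qPochSubInv q N n / qPoch q (N + k) - 1 ∈ qIdeal R q (N - n + 1) := by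
  have h1 := qPoch_add_div_sub_one_mem hq hqR (N - n) n
  have h2 := qIdeal_mono hqR (show N - n + 1 ≤ N + 1 by omega)
    (qPoch_div_add_sub_one_mem hq hqR hinv N k)
  have h3 := mul_sub_one_mem_qIdeal (mem_of_sub_one_mem_qIdeal hqR h1) h1 h2
  rw [Nat.sub_add_cancel hn] at h3
  convert h3 using 2
  simp only [qPochSubInv, hn, if_true]
  ring

lemma bailey_kernel_sum (hq : ∀ n, q ^ (n + 1) ≠ 1) (hqR : q ∈ R)
    (hinv : ∀ n, (1 - q ^ (n + 1))⁻¹ ∈ R) (hq0 : q ≠ 0) (N n : ℕ) (hn : 0 < n) :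
    ∑ m ∈ range N, q ^ (m + 1) * qPoch q m ^ 2 *
        (qPochSubInv q (m + 1) n / qPoch q (m + 1 + n)) - q ^ n * ((1 - q ^ n)⁻¹) ^ 2
      ∈ qIdeal R q (N + 1) := by
  have hbig : ∀ n, N + 1 ≤ n → ∑ m ∈ range N, q ^ (m + 1) * qPoch q m ^ 2 *
        (qPochSubInv q (m + 1) n / qPoch q (m + 1 + n)) - q ^ n * ((1 - q ^ n)⁻¹) ^ 2
      ∈ qIdeal R q (N + 1) := by
    intro n hn
    obtain ⟨c, rfl⟩ := Nat.exists_eq_add_of_le hn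
    rw [sum_eq_zero, zero_sub]
    · refine neg_mem (mem_qIdeal.mpr ⟨q ^ c * ((1 - q ^ (N + c + 1))⁻¹) ^ 2,
        mul_mem (pow_mem hqR _) (pow_mem (hinv _) _), ?_⟩)
      rw [show N + 1 + c = N + c + 1 by ring]
      ring
    · intro m hm
      rw [qPochSubInv_of_lt q (by grind)]
      simp
  rcases le_or_gt (N + 1) n with h | h
  · exact hbig n h
  obtain ⟨k, hk⟩ := Nat.exists_eq_add_of_le h.le
  induction k generalizing n with
  | zero => omega
  | succ k ih =>
    have ih' : ∑ m ∈ range N, q ^ (m + 1) * qPoch q m ^ 2 *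
        (qPochSubInv q (m + 1) (n + 1) / qPoch q (m + 1 + (n + 1)))
        - q ^ (n + 1) * ((1 - q ^ (n + 1))⁻¹) ^ 2 ∈ qIdeal R q (N + 1) := by
      rcases le_or_gt (N + 1) (n + 1) with h' | h'
      · exact hbig _ h'
      · exact ih (n + 1) (by omega) h' (by omega)
    have key := bailey_kernel_recurrence hq0 hq N n hn
    have h3 := qPoch_sq_ratio_sub_one_mem hq hqR hinv (Nat.lt_succ_iff.mp h) (n + 1)
    rw [← add_assoc] at h3
    have h4 := pow_mul_mem_qIdeal (M := n) (L := N + 1) hqR (by omega) h3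
    obtain ⟨n, rfl⟩ := Nat.exists_eq_add_one_of_ne_zero hn.ne'
    have n1 := one_sub_pow_ne_zero hq n
    have n2 := one_sub_pow_ne_zero hq (n + 1)
    set y := q ^ (n + 1) with hy
    set T := ∑ m ∈ range N, q ^ (m + 1) * qPoch q m ^ 2 *
        (qPochSubInv q (m + 1) (n + 1) / qPoch q (m + 1 + (n + 1)))
    set T' := ∑ m ∈ range N, q ^ (m + 1) * qPoch q m ^ 2 *
        (qPochSubInv q (m + 1) (n + 1 + 1) / qPoch q (m + 1 + (n + 1 + 1)))
    set h := qPoch q N ^ 2 * qPochSubInv q N (n + 1) / qPoch q (N + (n + 1) + 1)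
    have hyR : y ∈ R := pow_mem hqR _
    have e : T - y * ((1 - y)⁻¹) ^ 2 = ((1 - y)⁻¹) ^ 2 * (1 - q ^ (2 * (n + 1) + 1)) *
          (y * (h - 1)) + (((1 - y)⁻¹) ^ 2 * y ^ 2 * (1 - q ^ (n + 1 + 1)) ^ 2) *
          (T' - q ^ (n + 1 + 1) * ((1 - q ^ (n + 1 + 1))⁻¹) ^ 2) := by
      have hq2 : q ^ (n + 1 + 1) = q * y := by rw [hy]; ring
      have hq3 : q ^ (2 * (n + 1) + 1) = q * y ^ 2 := by rw [hy]; ring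
      rw [hq2] at n2 key ⊢
      rw [hq3] at key ⊢
      have hc := mul_inv_cancel₀ n2
      have hd := mul_inv_cancel₀ n1
      linear_combination ((1 - y)⁻¹) ^ 2 * key - T * ((1 - y) * (1 - y)⁻¹ + 1) * hd
        + ((1 - y)⁻¹) ^ 2 * y ^ 3 * q * ((1 - q * y) * (1 - q * y)⁻¹ + 1) * hc
    rw [e]
    refine add_mem (mul_mem_qIdeal ?_ h4) (mul_mem_qIdeal ?_ ih')
    · exact mul_mem (pow_mem (hinv _) _) (sub_mem (one_mem _) (pow_mem hqR _))
    · exact mul_mem (mul_mem (pow_mem (hinv _) _) (pow_mem hyR _))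
        (pow_mem (sub_mem (one_mem _) (pow_mem hqR _)) _)

/-- Gauss's identity `∑ (-1)^r q^{r^2} = (q; q)_∞ / (-q; q)_∞`, truncated. -/
lemma theta_sub_qPoch_div_mem (hq : ∀ n, q ^ (n + 1) ≠ 1) (hqR : q ∈ R)
    (hinv : ∀ n, (1 - q ^ (n + 1))⁻¹ ∈ R) (hq0 : q ≠ 0) (N : ℕ) :
    1 + 2 * ∑ r ∈ range N, (-1) ^ (r + 1) * q ^ (r + 1) ^ 2 - qPoch q N / qPochNeg q N
      ∈ qIdeal R q (N + 1) := by
  have h := gauss_theta_sum hq0 hq N N le_rfl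
  have n1 := qPoch_ne_zero hq N
  have n2 := qPochNeg_ne_zero hq N
  have e : 1 + 2 * ∑ r ∈ range N, (-1) ^ (r + 1) * q ^ (r + 1) ^ 2 - qPoch q N / qPochNeg q N
      = ∑ r ∈ range N, -2 * (-1) ^ (r + 1) * (q ^ (r + 1) ^ 2 *
        (qPoch q N ^ 2 * qPochSubInv q N (r + 1) / qPoch q (N + (r + 1)) - 1)) := by
    have e1 : qPoch q N / qPochNeg q N =
        qPoch q N ^ 2 * (1 / (qPoch q N * qPochNeg q N)) := by
      field_simp
    rw [e1, ← h, qPochSubInv_zero_right, mul_add, mul_sum, mul_sum, mul_sum]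
    have e2 : qPoch q N ^ 2 * ((qPoch q N)⁻¹ / qPoch q N) = 1 := by
      field_simp
    rw [e2, add_sub_add_left_eq_sub, ← sum_sub_distrib]
    exact sum_congr rfl fun r _ => by ring
  rw [e]
  refine sum_mem fun r hr => mul_mem_qIdeal ?_ ?_
  · exact mul_mem (neg_mem (ofNat_mem _ _)) (pow_mem (neg_mem (one_mem _)) _)
  · have hr := mem_range.mp hr
    refine pow_mul_mem_qIdeal hqR ?_
      (qPoch_sq_ratio_sub_one_mem hq hqR hinv (Nat.succ_le_of_lt hr) (r + 1))
    have : r + 1 ≤ (r + 1) ^ 2 := Nat.le_self_pow two_ne_zero _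
    omega

/-- The truncated product of the theta series and the generating function of odd smallest parts
in overpartitions. -/
lemma theta_mul_smallest_parts_mem [CharZero K] (hq : ∀ n, q ^ (n + 1) ≠ 1) (hqR : q ∈ R)
    (hinv : ∀ n, (1 - q ^ (n + 1))⁻¹ ∈ R) (hq0 : q ≠ 0) (N : ℕ) :
    (1 + 2 * ∑ r ∈ range N, (-1) ^ (r + 1) * q ^ (r + 1) ^ 2) *
      (∑ m ∈ range N, if Odd (m + 1) then 2 * q ^ (m + 1) * ((1 - q ^ (m + 1))⁻¹) ^ 2 *
        ∏ j ∈ Ico (m + 1) N, (1 + q ^ (j + 1)) * (1 - q ^ (j + 1))⁻¹ else 0)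
      - 2 * ∑ r ∈ range N, (-1) ^ r *
        (q ^ (r + 1) * (1 - q ^ (r + 1) ^ 2) * ((1 - q ^ (r + 1))⁻¹) ^ 2)
      ∈ qIdeal R q (N + 1) := by
  set Θ := 1 + 2 * ∑ r ∈ range N, (-1) ^ (r + 1) * q ^ (r + 1) ^ 2 with hΘ
  set P := ∑ m ∈ range N, if Odd (m + 1) then 2 * q ^ (m + 1) * ((1 - q ^ (m + 1))⁻¹) ^ 2 *
        ∏ j ∈ Ico (m + 1) N, (1 + q ^ (j + 1)) * (1 - q ^ (j + 1))⁻¹ else 0 with hP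
  have hPR : P ∈ R := by
    refine sum_mem fun m _ => ?_
    split_ifs
    · refine mul_mem (mul_mem (mul_mem (ofNat_mem _ _) (pow_mem hqR _)) (pow_mem (hinv _) _))
        (prod_mem fun j _ => mul_mem (add_mem (one_mem _) (pow_mem hqR _)) (hinv _))
    · exact zero_mem _
  have hmain : P * (qPoch q N / qPochNeg q N) = 2 * ∑ r ∈ range N,
      (-1) ^ (r + 1) * (q ^ (r + 1) ^ 2 - 1) * ∑ m ∈ range N, q ^ (m + 1) * qPoch q m ^ 2 *
        (qPochSubInv q (m + 1) (r + 1) / qPoch q (m + 1 + (r + 1))) := by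
    simp_rw [mul_sum (range N)]
    rw [sum_comm, hP, sum_mul]
    refine sum_congr rfl fun m hm => ?_
    have hm := mem_range.mp hm
    have hb := bailey_pair_odd hq0 hq N (m + 1) hm
    have e1 : ∑ r ∈ range N, 2 * ((-1) ^ (r + 1) * (q ^ (r + 1) ^ 2 - 1) * (q ^ (m + 1) *
        qPoch q m ^ 2 * (qPochSubInv q (m + 1) (r + 1) / qPoch q (m + 1 + (r + 1))))) =
        2 * q ^ (m + 1) * qPoch q m ^ 2 * ∑ r ∈ range N, (-1) ^ (r + 1) *
        (q ^ (r + 1) ^ 2 - 1) * (qPochSubInv q (m + 1) (r + 1)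
        / qPoch q (m + 1 + (r + 1))) := by
      rw [mul_sum]
      exact sum_congr rfl fun r _ => by ring
    rw [e1, hb]
    split_ifs with h
    · have p1 : qPoch q (m + 1) * ∏ j ∈ Ico (m + 1) N, (1 - q ^ (j + 1)) = qPoch q N :=
        prod_range_mul_prod_Ico _ hm
      have p2 : qPochNeg q (m + 1) * ∏ j ∈ Ico (m + 1) N, (1 + q ^ (j + 1)) = qPochNeg q N :=
        prod_range_mul_prod_Ico _ hm
      rw [prod_mul_distrib, prod_inv_distrib, ← p1, ← p2]
      have n1 : ∏ j ∈ Ico (m + 1) N, (1 - q ^ (j + 1)) ≠ 0 :=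
        prod_ne_zero_iff.mpr fun i _ => one_sub_pow_ne_zero hq i
      have n2 : ∏ j ∈ Ico (m + 1) N, (1 + q ^ (j + 1)) ≠ 0 :=
        prod_ne_zero_iff.mpr fun i _ => one_add_pow_ne_zero hq i
      have n3 := qPoch_ne_zero hq m
      have n4 := qPochNeg_ne_zero hq (m + 1)
      have n5 := one_sub_pow_ne_zero hq m
      rw [qPoch_succ]
      field_simp
    · simp
  have e : Θ * P - 2 * ∑ r ∈ range N, (-1) ^ r *
        (q ^ (r + 1) * (1 - q ^ (r + 1) ^ 2) * ((1 - q ^ (r + 1))⁻¹) ^ 2)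
      = P * (Θ - qPoch q N / qPochNeg q N) + 2 * ∑ r ∈ range N,
      (-1) ^ (r + 1) * (q ^ (r + 1) ^ 2 - 1) * (∑ m ∈ range N, q ^ (m + 1) * qPoch q m ^ 2 *
        (qPochSubInv q (m + 1) (r + 1) / qPoch q (m + 1 + (r + 1)))
        - q ^ (r + 1) * ((1 - q ^ (r + 1))⁻¹) ^ 2) := by
    rw [mul_sub P, hmain]
    simp_rw [mul_sub _ (∑ m ∈ range N, _), sum_sub_distrib]
    have e2 : ∑ r ∈ range N, (-1) ^ (r + 1) * (q ^ (r + 1) ^ 2 - 1) *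
        (q ^ (r + 1) * ((1 - q ^ (r + 1))⁻¹) ^ 2) = ∑ r ∈ range N, (-1) ^ r *
        (q ^ (r + 1) * (1 - q ^ (r + 1) ^ 2) * ((1 - q ^ (r + 1))⁻¹) ^ 2) :=
      sum_congr rfl fun r _ => by ring
    rw [e2]
    ring
  rw [e]
  refine add_mem (mul_mem_qIdeal hPR (theta_sub_qPoch_div_mem hq hqR hinv hq0 N))
    (mul_mem_qIdeal (ofNat_mem _ _) (sum_mem fun r _ => mul_mem_qIdeal ?_
      (bailey_kernel_sum hq hqR hinv hq0 N (r + 1) r.succ_pos)))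
  exact mul_mem (pow_mem (neg_mem (one_mem _)) _) (sub_mem (pow_mem hqR _) (one_mem _))

end Truncation

end QSeries

section Divisors

open Finset

lemma sum_divisors_even_even {M : Type*} [AddCommMonoid M] (k : ℕ) (hk : 0 < k) (f : ℕ → M) :
    ∑ d ∈ (4 * k).divisors with Even d ∧ Even (4 * k / d), f d = ∑ d ∈ k.divisors, f (2 * d) := by
  symm
  refine sum_nbij (fun d => 2 * d) ?_ ?_ ?_ fun _ _ => rfl
  · intro d hd
    obtain ⟨⟨e, rfl⟩, -⟩ := Nat.mem_divisors.mp hd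
    have hd0 : 0 < d := Nat.pos_of_mul_pos_right hk
    have : 4 * (d * e) = 2 * d * (2 * e) := by ring
    simp only [mem_filter, Nat.mem_divisors, this]
    rw [Nat.mul_div_cancel_left _ (by omega)]
    exact ⟨⟨⟨_, rfl⟩, by rw [← this]; omega⟩, even_two_mul _, even_two_mul _⟩
  · intro a _ b _ h
    simpa using h
  · intro d hd
    simp only [mem_coe, mem_filter, Nat.mem_divisors] at hd
    obtain ⟨⟨⟨e, he⟩, -⟩, ⟨a, rfl⟩, hb⟩ := hd
    have ha : 0 < a + a := by
      rcases Nat.eq_zero_or_pos a with rfl | h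
      · omega
      · omega
    rw [he, Nat.mul_div_cancel_left _ ha] at hb
    obtain ⟨b, rfl⟩ := hb
    refine ⟨a, ?_, by ring⟩
    simp only [mem_coe, Nat.mem_divisors]
    exact ⟨⟨b, by linarith⟩, hk.ne'⟩

/-- `b(n)` as a single signed divisor sum. -/
lemma bfun_eq_sum_divisors (n : ℕ) (hn : 0 < n) :
    bfun n = 2 * ∑ d ∈ n.divisors, (-1) ^ (d + 1) * ((min d (n / d) : ℕ) : ℤ) := by
  have hsymm : 2 * ∑ d ∈ n.divisors, (-1) ^ (d + 1) * ((min d (n / d) : ℕ) : ℤ) =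
      ∑ d ∈ n.divisors, ((-1) ^ (d + 1) + (-1) ^ (n / d + 1)) * ((min d (n / d) : ℕ) : ℤ) := by
    rw [two_mul]
    nth_rw 2 [← Nat.sum_div_divisors]
    rw [← sum_add_distrib]
    refine sum_congr rfl fun d hd => ?_
    rw [Nat.div_div_self (Nat.dvd_of_mem_divisors hd) hn.ne', min_comm (n / d)]
    ring
  unfold bfun
  split_ifs with h1 h2
  · have hodd : Odd n := Nat.odd_iff.mpr h1
    rw [hodd.add_one.neg_one_pow, one_mul, sdiv, Nat.cast_sum]
    congr 1
    refine sum_congr rfl fun d hd => ?_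
    rw [(hodd.of_dvd_nat (Nat.dvd_of_mem_divisors hd)).add_one.neg_one_pow, one_mul]
  · obtain ⟨k, rfl⟩ := Nat.dvd_of_mod_eq_zero h2
    have hk : 0 < k := by omega
    rw [hsymm, Nat.mul_div_cancel_left _ (by norm_num)]
    have he : Odd (4 * k + 1) := ⟨2 * k, by ring⟩
    have h3 : ∑ d ∈ (4 * k).divisors,
        ((-1) ^ (d + 1) + (-1) ^ (4 * k / d + 1)) * ((min d (4 * k / d) : ℕ) : ℤ) =
        ∑ d ∈ (4 * k).divisors with Even d ∧ Even (4 * k / d),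
          -2 * ((min d (4 * k / d) : ℕ) : ℤ) := by
      rw [sum_filter]
      refine sum_congr rfl fun d hd => ?_
      have hdvd := Nat.div_mul_cancel (Nat.dvd_of_mem_divisors hd)
      have hev : Even (4 * k / d * d) := by rw [hdvd]; exact ⟨2 * k, by ring⟩
      rw [Nat.even_mul] at hev
      rcases Nat.even_or_odd d with h | h <;> rcases Nat.even_or_odd (4 * k / d) with h' | h'
      · simp [h, h', h.add_one.neg_one_pow, h'.add_one.neg_one_pow]
      · simp [h, Nat.not_even_iff_odd.mpr h', h.add_one.neg_one_pow, h'.add_one.neg_one_pow]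
      · simp [h', Nat.not_even_iff_odd.mpr h, h.add_one.neg_one_pow, h'.add_one.neg_one_pow]
      · rw [← Nat.not_even_iff_odd] at h h'
        tauto
    rw [h3, sum_divisors_even_even k hk, he.neg_one_pow, sdiv, Nat.cast_sum, mul_sum, mul_sum]
    refine sum_congr rfl fun d hd => ?_
    obtain ⟨⟨e, rfl⟩, -⟩ := Nat.mem_divisors.mp hd
    have hd0 : 0 < d := Nat.pos_of_mul_pos_right hk
    have : 4 * (d * e) = 2 * d * (2 * e) := by ring
    rw [this, Nat.mul_div_cancel_left _ (by omega : 0 < 2 * d), Nat.mul_div_cancel_left _ hd0]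
    omega
  · rw [hsymm, sum_eq_zero]
    intro d hd
    have hdvd := Nat.div_mul_cancel (Nat.dvd_of_mem_divisors hd)
    rcases Nat.even_or_odd d with h | h <;> rcases Nat.even_or_odd (n / d) with h' | h'
    · obtain ⟨a, ha⟩ := h
      obtain ⟨b, hb⟩ := h'
      rw [ha] at hdvd hb
      rw [hb] at hdvd
      have : n = 4 * (b * a) := by rw [← hdvd]; ring
      omega
    · simp [h.add_one.neg_one_pow, h'.add_one.neg_one_pow]
    · simp [h.add_one.neg_one_pow, h'.add_one.neg_one_pow]
    · have := Nat.odd_iff.mp (h'.mul h)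
      rw [hdvd] at this
      omega

end Divisors

section GeneratingFunctions

open Finset PowerSeries

open scoped PowerSeries.WithPiTopology

/-- The power series `1 + ∑_{c ≥ 1} f(c) X^{kc}`. -/
noncomputable def partSeries {R : Type*} [CommSemiring R] (k : ℕ) (f : ℕ → R) : R⟦X⟧ :=
  PowerSeries.mk fun n => if n = 0 then 1 else if k ∣ n then f (n / k) else 0

lemma one_add_tsum_eq_partSeries {R : Type*} [CommSemiring R] [TopologicalSpace R] [T2Space R]
    (k : ℕ) (hk : 0 < k) (f : ℕ → R) :
    1 + ∑' j, f (j + 1) • (X : R⟦X⟧) ^ (k * (j + 1)) = partSeries k f := by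
  ext n
  have hs : Summable fun j => f (j + 1) • (X : R⟦X⟧) ^ (k * (j + 1)) :=
    Nat.Partition.summable_genFun_term' (fun _ => f) hk.ne'
  rw [map_add, hs.map_tsum _ (WithPiTopology.continuous_coeff _ _), partSeries, coeff_mk]
  simp only [map_smul, coeff_X_pow, coeff_one, smul_eq_mul, mul_ite, mul_one,
    mul_zero]
  split_ifs with h0 hd
  · subst h0
    have : ∀ j, (0 = k * (j + 1)) = False := fun j => by simp [hk.ne']
    simp [this]
  · obtain ⟨c, rfl⟩ := hd
    obtain ⟨c, rfl⟩ := Nat.exists_eq_add_one_of_ne_zero (right_ne_zero_of_mul h0)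
    rw [tsum_eq_single c, Nat.mul_div_cancel_left _ hk]
    · simp
    · intro j hj
      rw [if_neg]
      intro h
      have := Nat.eq_of_mul_eq_mul_left hk h
      omega
  · have : ∀ j, (n = k * (j + 1)) = False := fun j => eq_false fun h => hd ⟨_, h⟩
    simp [this]

lemma genFun_eq_prod {R : Type*} [CommSemiring R] [TopologicalSpace R] [T2Space R] (N : ℕ)
    (f : ℕ → ℕ → R) (hf : ∀ i, N < i → ∀ c, f i c = 0) :
    Nat.Partition.genFun f = ∏ i ∈ range N, partSeries (i + 1) (f (i + 1)) := by
  have h := Nat.Partition.hasProd_genFun f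
  have e (i : ℕ) := one_add_tsum_eq_partSeries (i + 1) i.succ_pos (f (i + 1))
  simp only [e] at h
  refine h.unique (hasProd_prod_of_ne_finset_one fun i hi => ?_)
  ext n
  simp only [mem_range, not_lt] at hi
  simp [partSeries, hf (i + 1) (by omega), coeff_one]

lemma partSeries_zero (k : ℕ) : partSeries k (fun _ => (0 : ℤ)) = 1 := by
  ext n
  simp [partSeries, coeff_one]

lemma mul_one_sub_X_pow_eq {k : ℕ} {A B : ℤ⟦X⟧}
    (h0 : ∀ r < k, coeff r A = coeff r B)
    (h : ∀ n, coeff (n + k) A - coeff n A = coeff (n + k) B) : A * (1 - X ^ k) = B := by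
  ext n
  rw [mul_sub, mul_one, map_sub, coeff_mul_X_pow']
  split_ifs with hn
  · obtain ⟨m, rfl⟩ := Nat.exists_eq_add_of_le' hn
    simpa using h m
  · simpa using h0 n (by omega)

lemma partSeries_two (k : ℕ) (hk : 0 < k) :
    partSeries k (fun _ => (2 : ℤ)) * (1 - X ^ k) = 1 + X ^ k := by
  refine mul_one_sub_X_pow_eq ?_ ?_
  · intro r hr
    rcases Nat.eq_zero_or_pos r with rfl | h
    · simp [partSeries, hk.ne']
    · simp [partSeries, coeff_X_pow, coeff_one, h.ne', hr.ne, Nat.not_dvd_of_pos_of_lt h hr]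
  · intro n
    rcases Nat.eq_zero_or_pos n with rfl | h
    · simp [partSeries, coeff_one, coeff_X_pow, hk.ne']
    · simp [partSeries, coeff_one, coeff_X_pow, hk.ne', h.ne']

lemma partSeries_two_mul (k : ℕ) (hk : 0 < k) :
    (partSeries k (fun c => (2 * c : ℤ)) - 1) * (1 - X ^ k) ^ 2 = 2 * X ^ k := by
  have h1 : (partSeries k (fun c => (2 * c : ℤ)) - 1) * (1 - X ^ k) =
      partSeries k (fun _ => (2 : ℤ)) - 1 := by
    refine mul_one_sub_X_pow_eq ?_ ?_
    · intro r hr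
      rcases Nat.eq_zero_or_pos r with rfl | h
      · simp [partSeries]
      · simp [partSeries, h.ne', Nat.not_dvd_of_pos_of_lt h hr]
    · intro n
      rcases Nat.eq_zero_or_pos n with rfl | h
      · simp [partSeries, hk.ne', coeff_one]
      · simp only [map_sub, partSeries, coeff_mk, coeff_one, h.ne', hk.ne', if_false,
          Nat.dvd_add_self_right, Nat.add_eq_zero_iff, and_false, Nat.add_div_right _ hk]
        split_ifs
        · push_cast
          ring
        · ring
  rw [pow_two, ← mul_assoc, h1, sub_mul, partSeries_two k hk]
  ring

/-- The power series `∑_{e ≥ 1} min(k, e) X^{ke}`. -/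
noncomputable def minSeries (k : ℕ) : ℤ⟦X⟧ :=
  PowerSeries.mk fun n => if k ∣ n then ((min k (n / k) : ℕ) : ℤ) else 0

lemma minSeries_mul (k : ℕ) (hk : 0 < k) :
    minSeries k * (1 - X ^ k) ^ 2 = X ^ k * (1 - X ^ k ^ 2) := by
  rw [pow_two, ← mul_assoc]
  have h1 : minSeries k * (1 - X ^ k) =
      PowerSeries.mk fun n => if k ∣ n ∧ 0 < n ∧ n ≤ k ^ 2 then 1 else 0 := by
    refine mul_one_sub_X_pow_eq ?_ ?_
    · intro r hr
      rcases Nat.eq_zero_or_pos r with rfl | h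
      · simp [minSeries]
      · simp [minSeries, Nat.not_dvd_of_pos_of_lt h hr]
    · intro n
      simp only [minSeries, coeff_mk, Nat.dvd_add_self_right]
      by_cases hd : k ∣ n
      · obtain ⟨e, rfl⟩ := hd
        have h2 : k * e + k = k * (e + 1) := by ring
        have h3 : k * (e + 1) ≤ k ^ 2 ↔ e + 1 ≤ k := by
          rw [pow_two, Nat.mul_le_mul_left_iff hk]
        have h4 : 0 < k * (e + 1) := by positivity
        simp only [dvd_mul_right, h2, if_true, Nat.mul_div_cancel_left _ hk, h3, h4, true_and]
        split_ifs <;> omega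
      · simp [hd]
  rw [h1]
  refine mul_one_sub_X_pow_eq ?_ ?_
  · intro r hr
    rw [coeff_X_pow_mul', if_neg (by omega), coeff_mk, if_neg]
    rintro ⟨h, h', -⟩
    exact Nat.not_dvd_of_pos_of_lt h' hr h
  · intro n
    rw [coeff_X_pow_mul]
    simp only [coeff_mk, map_sub, coeff_one, coeff_X_pow, Nat.dvd_add_self_right]
    by_cases hd : k ∣ n
    · obtain ⟨e, rfl⟩ := hd
      have h2 : k * e + k = k * (e + 1) := by ring
      have h3 : k * (e + 1) ≤ k ^ 2 ↔ e + 1 ≤ k := by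
        rw [pow_two, Nat.mul_le_mul_left_iff hk]
      have h3' : k * e ≤ k ^ 2 ↔ e ≤ k := by
        rw [pow_two, Nat.mul_le_mul_left_iff hk]
      have h5 : k * e = k ^ 2 ↔ e = k := by
        rw [pow_two, Nat.mul_right_inj hk.ne']
      have h4 : 0 < k * (e + 1) := by positivity
      have h6 : 0 < k * e ↔ 0 < e := by simp [hk]
      have h7 : k * e = 0 ↔ e = 0 := by simp [hk.ne']
      simp only [dvd_mul_right, h2, h3, h3', h4, h5, h6, h7, true_and]
      split_ifs <;> omega
    · have h8 : ¬ n = 0 := by rintro rfl; simp at hd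
      have h9 : ¬ n = k ^ 2 := by rintro rfl; exact hd ⟨k, pow_two k⟩
      simp [hd, h8, h9]

/-- The weight of `c` copies of the part `i` in a partition into parts from `m` to `N`,
where the part `m` is weighted by `w` and the larger parts may be overlined. -/
def overWeight (N m : ℕ) (w : ℕ → ℤ) (i c : ℕ) : ℤ :=
  if i = m then w c else if m < i ∧ i ≤ N then 2 else 0

lemma smallestPart_eq_iff {n m : ℕ} (π : n.Partition) (hm : 0 < m) :
    π.smallestPart = m ↔ m ∈ π.parts ∧ ∀ i ∈ π.parts, m ≤ i := by
  unfold Nat.Partition.smallestPart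
  constructor
  · rintro rfl
    exact ⟨Nat.sInf_mem (Nat.nonempty_of_pos_sInf hm), fun i hi => Nat.sInf_le hi⟩
  · rintro ⟨h1, h2⟩
    exact le_antisymm (Nat.sInf_le h1) (le_csInf ⟨m, h1⟩ h2)

lemma prod_overWeight_sub {N n m : ℕ} (hn : n ≤ N) (hm : 0 < m) (π : n.Partition) :
    π.parts.toFinsupp.prod (overWeight N m fun c => 2 * c)
      - π.parts.toFinsupp.prod (overWeight N m fun _ => 0)
      = if π.smallestPart = m then 2 ^ #π.parts.toFinset * (π.parts.count m : ℤ) else 0 := by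
  simp only [Finsupp.prod, Multiset.toFinsupp_support, Multiset.toFinsupp_apply]
  by_cases hmem : m ∈ π.parts
  · have hmem' : m ∈ π.parts.toFinset := Multiset.mem_toFinset.mpr hmem
    rw [prod_eq_zero (f := fun i => overWeight N m (fun _ => 0) i (π.parts.count i)) hmem'
      (by simp [overWeight]), sub_zero, ← mul_prod_erase _ _ hmem']
    split_ifs with h
    · obtain ⟨-, h⟩ := (smallestPart_eq_iff π hm).mp h
      rw [prod_congr rfl (g := fun _ => 2), prod_const, card_erase_of_mem hmem']
      · obtain ⟨c, hc⟩ := Nat.exists_eq_add_one_of_ne_zero (card_ne_zero_of_mem hmem')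
        rw [hc]
        simp only [overWeight, if_true, Nat.add_sub_cancel]
        ring
      · intro i hi
        obtain ⟨hi1, hi2⟩ := mem_erase.mp hi
        rw [Multiset.mem_toFinset] at hi2
        have h1 := h i hi2
        have h2 : i ≤ n := Nat.Partition.le_of_mem_parts hi2
        rw [overWeight, if_neg hi1, if_pos ⟨by omega, by omega⟩]
    · rw [smallestPart_eq_iff π hm] at h
      push Not at h
      obtain ⟨i, hi, him⟩ := h hmem
      rw [prod_eq_zero (i := i), mul_zero]
      · exact mem_erase.mpr ⟨him.ne, Multiset.mem_toFinset.mpr hi⟩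
      · rw [overWeight, if_neg him.ne, if_neg (by omega)]
  · rw [if_neg (fun h => hmem ((smallestPart_eq_iff π hm).mp h).1), sub_eq_zero]
    refine prod_congr rfl fun i hi => ?_
    have : i ≠ m := by
      rintro rfl
      exact hmem (Multiset.mem_toFinset.mp hi)
    simp [overWeight, this]

lemma genFun_overWeight (N m : ℕ) (hm : m < N) (w : ℕ → ℤ) :
    Nat.Partition.genFun (overWeight N (m + 1) w) =
      partSeries (m + 1) w * ∏ j ∈ Ico (m + 1) N, partSeries (j + 1) (fun _ => (2 : ℤ)) := by
  rw [genFun_eq_prod N]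
  · rw [← prod_range_mul_prod_Ico _ (Nat.succ_le_of_lt hm), prod_range_succ, prod_eq_one, one_mul]
    · congr 1
      · congr 1
        ext c
        simp [overWeight]
      · refine prod_congr rfl fun j hj => ?_
        congr 1
        ext c
        obtain ⟨h1, h2⟩ := mem_Ico.mp hj
        rw [overWeight, if_neg (by omega), if_pos ⟨by omega, by omega⟩]
    · intro j hj
      have hj := mem_range.mp hj
      rw [← partSeries_zero (j + 1)]
      congr 1
      ext c
      rw [overWeight, if_neg (by omega), if_neg (by omega)]
  · intro i hi c
    rw [overWeight, if_neg (by omega), if_neg (by omega)]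

/-- The generating function of `sptbar` restricted to parts of size at most `N`. -/
noncomputable def sptbarSeries (N : ℕ) : ℤ⟦X⟧ :=
  ∑ m ∈ range N, if Odd (m + 1) then
    Nat.Partition.genFun (overWeight N (m + 1) fun c => 2 * c)
      - Nat.Partition.genFun (overWeight N (m + 1) fun _ => 0) else 0

lemma coeff_sptbarSeries {N n : ℕ} (hn : n ≤ N) : coeff n (sptbarSeries N) = sptbar n := by
  have h (m : ℕ) : coeff n (if Odd (m + 1) then
      Nat.Partition.genFun (overWeight N (m + 1) fun c => 2 * c)
      - Nat.Partition.genFun (overWeight N (m + 1) fun _ => 0) else 0) =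
      ∑ π : n.Partition, if π.smallestPart = m + 1 then
        if Odd π.smallestPart then 2 ^ #π.parts.toFinset * (π.parts.count π.smallestPart : ℤ)
        else 0 else 0 := by
    split_ifs with ho
    · rw [map_sub, Nat.Partition.coeff_genFun, Nat.Partition.coeff_genFun, ← sum_sub_distrib]
      refine sum_congr rfl fun π _ => ?_
      rw [prod_overWeight_sub hn m.succ_pos]
      split_ifs with h1 h2
      · rw [h1]
      · rw [h1] at h2
        exact absurd ho h2
      · rfl
    · rw [map_zero]
      refine (sum_eq_zero fun π _ => ?_).symm
      split_ifs with h1 h2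
      · rw [h1] at h2
        exact absurd h2 ho
      · rfl
      · rfl
  rw [sptbarSeries, map_sum]
  simp_rw [h]
  rw [sum_comm, sptbar, Nat.cast_sum]
  refine sum_congr rfl fun π _ => ?_
  rw [sum_const, card_powerset, smul_eq_mul]
  rcases Nat.eq_zero_or_pos π.smallestPart with h0 | h0
  · simp [h0]
  · obtain ⟨m, hm⟩ := Nat.exists_eq_add_one_of_ne_zero h0.ne'
    have h1 := ((smallestPart_eq_iff π h0).mp rfl).1
    have h2 : π.smallestPart ≤ n := Nat.Partition.le_of_mem_parts h1
    rw [sum_eq_single_of_mem m (mem_range.mpr (by omega))]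
    · rw [if_pos hm]
      push_cast
      split_ifs <;> simp
    · intro j _ hj
      rw [if_neg (by omega)]

lemma X_pow_dvd_theta_mul_sptbarSeries (N : ℕ) :
    X ^ (N + 1) ∣ (1 + 2 * ∑ r ∈ range N, (-1) ^ (r + 1) * X ^ (r + 1) ^ 2) * sptbarSeries N
      - 2 * ∑ r ∈ range N, (-1) ^ r * minSeries (r + 1) := by
  let φ := algebraMap ℤ⟦X⟧ (FractionRing ℤ⟦X⟧)
  have hφ : Function.Injective φ := IsFractionRing.injective _ _
  have hX : φ X ≠ 0 := by
    rw [Ne, map_eq_zero_iff φ hφ]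
    exact X_ne_zero
  have hq (n : ℕ) : φ X ^ (n + 1) ≠ 1 := by
    rw [← map_pow, ← map_one φ, hφ.ne_iff]
    intro h
    simpa using congrArg (coeff 0) h
  have hne (n : ℕ) := one_sub_pow_ne_zero hq n
  have hinv (n : ℕ) : (1 - φ X ^ (n + 1))⁻¹ ∈ φ.range := by
    have hu : IsUnit (1 - X ^ (n + 1) : ℤ⟦X⟧) := by
      rw [isUnit_iff_constantCoeff]
      simp
    obtain ⟨B, hB⟩ := hu.exists_right_inv
    refine ⟨B, ?_⟩
    refine eq_inv_of_mul_eq_one_right ?_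
    simpa using congrArg φ hB
  have h2 (j : ℕ) : φ (partSeries (j + 1) fun _ => (2 : ℤ)) =
      (1 + φ X ^ (j + 1)) * (1 - φ X ^ (j + 1))⁻¹ := by
    rw [eq_mul_inv_iff_mul_eq₀ (hne j)]
    simpa using congrArg φ (partSeries_two (j + 1) j.succ_pos)
  have h3 (j : ℕ) : φ (partSeries (j + 1) (fun c => (2 * c : ℤ)) - 1) =
      2 * φ X ^ (j + 1) * ((1 - φ X ^ (j + 1))⁻¹) ^ 2 := by
    rw [inv_pow, eq_mul_inv_iff_mul_eq₀ (pow_ne_zero _ (hne j))]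
    simpa [map_ofNat φ 2] using congrArg φ (partSeries_two_mul (j + 1) j.succ_pos)
  have h4 (j : ℕ) : φ (minSeries (j + 1)) =
      φ X ^ (j + 1) * (1 - φ X ^ (j + 1) ^ 2) * ((1 - φ X ^ (j + 1))⁻¹) ^ 2 := by
    rw [inv_pow, eq_mul_inv_iff_mul_eq₀ (pow_ne_zero _ (hne j))]
    simpa using congrArg φ (minSeries_mul (j + 1) j.succ_pos)
  have h5 : φ (sptbarSeries N) = ∑ m ∈ range N, if Odd (m + 1) then
      2 * φ X ^ (m + 1) * ((1 - φ X ^ (m + 1))⁻¹) ^ 2 *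
        ∏ j ∈ Ico (m + 1) N, (1 + φ X ^ (j + 1)) * (1 - φ X ^ (j + 1))⁻¹ else 0 := by
    rw [sptbarSeries, map_sum]
    refine sum_congr rfl fun m hm => ?_
    have hm := mem_range.mp hm
    split_ifs
    · rw [genFun_overWeight N m hm, genFun_overWeight N m hm, ← sub_mul, partSeries_zero, map_mul,
        h3, map_prod]
      simp_rw [h2]
    · exact map_zero φ
  have : CharZero (FractionRing ℤ⟦X⟧) :=
    charZero_of_injective_ringHom (f := φ.comp (C (R := ℤ))) (hφ.comp C_injective)
  have key := theta_mul_smallest_parts_mem (R := φ.range) hq ⟨X, rfl⟩ hinv hX N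
  obtain ⟨_, ⟨B, rfl⟩, hB⟩ := mem_qIdeal.mp key
  refine ⟨B, hφ ?_⟩
  simp only [map_mul, map_sub, map_add, map_sum, map_pow, map_one, map_neg, map_ofNat, h4, h5]
  exact hB.symm

end GeneratingFunctions

section Recurrence

open Finset PowerSeries

lemma finsum_sptbarZ_eq (n : ℕ) :
    ∑ᶠ k : ℤ, (k.negOnePow : ℤ) * sptbarZ ((n : ℤ) - k ^ 2) =
      sptbar n + 2 * ∑ r ∈ range n, (-1) ^ (r + 1) *
        (if (r + 1) ^ 2 ≤ n then (sptbar (n - (r + 1) ^ 2) : ℤ) else 0) := by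
  set F : ℤ → ℤ := fun k => (k.negOnePow : ℤ) * sptbarZ ((n : ℤ) - k ^ 2) with hF
  have heven : F.Even := fun k => by simp [hF, Int.negOnePow_neg]
  have hsupp : Function.support F ⊆ (Icc (-(n : ℤ)) n : Finset ℤ) := by
    intro k hk
    by_contra h
    apply hk
    have : (n : ℤ) < k ^ 2 := by
      simp only [coe_Icc, Set.mem_Icc, not_and_or, not_le] at h
      rcases h with h | h <;> nlinarith
    simp only [hF, sptbarZ]
    rw [if_neg (by omega), mul_zero]
  have hval (r : ℕ) : F r = (-1) ^ r * (if r ^ 2 ≤ n then (sptbar (n - r ^ 2) : ℤ) else 0) := by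
    simp only [hF, sptbarZ, Int.coe_negOnePow_natCast]
    congr 1
    by_cases h : r ^ 2 ≤ n
    · rw [if_pos h, if_pos (by rw [sub_nonneg]; exact_mod_cast h)]
      congr 2
      rw [← Int.natCast_pow, ← Nat.cast_sub h, Int.toNat_natCast]
    · rw [if_neg h, if_neg (by rw [sub_nonneg]; exact_mod_cast h)]
  rw [finsum_eq_sum_of_support_subset F hsupp, sum_Icc_of_even_eq_range heven, sum_range_succ']
  have h0 : F 0 = sptbar n := by simpa using hval 0
  simp_rw [hval]
  rw [h0]
  simp
  ring

end Recurrence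

/-- Euler-like recurrence for `sptbar` (Theorem 2). -/
theorem sptbar_recurrence (n : ℕ) (hn : 0 < n) :
    ∑ᶠ k : ℤ, (k.negOnePow : ℤ) * sptbarZ ((n : ℤ) - k ^ 2) = bfun n := by
  have hdvd := X_pow_dvd_theta_mul_sptbarSeries n
  have hc := (PowerSeries.X_pow_dvd_iff.mp hdvd) n n.lt_succ_self
  rw [finsum_sptbarZ_eq, bfun_eq_sum_divisors n hn]
  have hθ : PowerSeries.coeff n ((1 + 2 * ∑ r ∈ Finset.range n,
      (-1) ^ (r + 1) * PowerSeries.X ^ (r + 1) ^ 2) * sptbarSeries n) =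
      sptbar n + 2 * ∑ r ∈ Finset.range n, (-1) ^ (r + 1) *
        (if (r + 1) ^ 2 ≤ n then (sptbar (n - (r + 1) ^ 2) : ℤ) else 0) := by
    have e : (1 + 2 * ∑ r ∈ Finset.range n,
        (-1) ^ (r + 1) * PowerSeries.X ^ (r + 1) ^ 2) * sptbarSeries n =
        sptbarSeries n + PowerSeries.C 2 * ∑ r ∈ Finset.range n,
          PowerSeries.C ((-1) ^ (r + 1)) *
            (sptbarSeries n * PowerSeries.X ^ (r + 1) ^ 2) := by
      rw [add_mul, one_mul, mul_assoc, Finset.sum_mul]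
      simp only [map_pow, map_neg, map_one, map_ofNat]
      congr 2
      exact Finset.sum_congr rfl fun r _ => by ring
    rw [e, map_add, PowerSeries.coeff_C_mul, map_sum, coeff_sptbarSeries le_rfl]
    congr 2
    refine Finset.sum_congr rfl fun r _ => ?_
    rw [PowerSeries.coeff_C_mul, PowerSeries.coeff_mul_X_pow']
    split_ifs
    · rw [coeff_sptbarSeries (Nat.sub_le _ _)]
    · rfl
  have hmin : PowerSeries.coeff n (2 * ∑ r ∈ Finset.range n, (-1) ^ r * minSeries (r + 1)) =
      2 * ∑ d ∈ n.divisors, (-1) ^ (d + 1) * ((min d (n / d) : ℕ) : ℤ) := by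
    have e : 2 * ∑ r ∈ Finset.range n, (-1) ^ r * minSeries (r + 1) =
        PowerSeries.C 2 * ∑ r ∈ Finset.range n,
          PowerSeries.C ((-1) ^ r) * minSeries (r + 1) := by
      simp only [map_pow, map_neg, map_one, map_ofNat]
    rw [e, PowerSeries.coeff_C_mul, map_sum, Nat.divisors, Finset.sum_filter,
      Finset.sum_Ico_eq_sum_range, Nat.add_sub_cancel]
    congr 1
    refine Finset.sum_congr rfl fun r _ => ?_
    rw [PowerSeries.coeff_C_mul, minSeries, PowerSeries.coeff_mk, add_comm 1 r]
    split_ifs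
    · ring
    · ring
  rw [map_sub, hθ, hmin] at hc
  linarith
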